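/- Let X be a Banach space, δ > 0 and α < ω₁. If the closed unit ball B_X contains a δ-α-sprawling tree (x_s)_{s∈S_α}, then its root x_∅ belongs to γ_δ^α(B_X); in particular C(X,δ) > α and C(X) > α. -/

import Mathlib

open Metric Set Topology

noncomputable section

/-- Transfinite iteration of a derivation `d` starting from `a`;
meets are taken at limit stages. -/
def derivIter {L : Type*} [CompleteLattice L] (d : L → L) (a : L) (α : Ordinal) : L :=
  Ordinal.limitRecOn α a (fun _ ih => d ih) (fun o _ ih => ⨅ (γ : Ordinal) (h : γ < o), ih γ h)

/-- The weak topology of a real normed space. -/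
def weakTop (X : Type*) [NormedAddCommGroup X] [NormedSpace ℝ X] : TopologicalSpace X :=
  TopologicalSpace.induced (fun (x : X) (f : X →L[ℝ] ℝ) => f x) inferInstance

variable {X : Type*} [NormedAddCommGroup X] [NormedSpace ℝ X]

/-- The dentability derivation `d_ε^1`. -/
def dentDeriv (ε : ℝ) (C : Set X) : Set X :=
  C \ ⋃ (f : X →L[ℝ] ℝ) (a : ℝ) (_ : Metric.diam ({y | a < f y} ∩ C) < ε), {y | a < f y}

/-- The weak fragmentation derivation `σ_ε^1`. -/
def weakDeriv (ε : ℝ) (C : Set X) : Set X :=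
  C \ ⋃ (V : Set X) (_ : IsOpen[weakTop X] V) (_ : Metric.diam (V ∩ C) < ε), V

/-- The convex weak fragmentation derivation `γ_ε^1`. -/
def convDeriv (ε : ℝ) (C : Set X) : Set X :=
  closure (convexHull ℝ (weakDeriv ε C))

/-- `treeRoot C δ α x` : `x` is the root of a `δ`-`α`-tree contained in `C`. -/
def treeRoot (C : Set X) (δ : ℝ) (α : Ordinal) : X → Prop :=
  Ordinal.limitRecOn α (fun x => x ∈ C)
    (fun _ ih x => x ∈ C ∧ ∃ y z : X,
      x = (2⁻¹ : ℝ) • (y + z) ∧ δ ≤ 2⁻¹ * ‖y - z‖ ∧ ih y ∧ ih z)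
    (fun o _ ih x => ∀ γ (h : γ < o), ih γ h x)

/-- `sprawlRoot C δ α x` : `x` is the root of a `δ`-`α`-sprawling tree contained in `C`. -/
def sprawlRoot (C : Set X) (δ : ℝ) (α : Ordinal) : X → Prop :=
  Ordinal.limitRecOn α (fun x => x ∈ C)
    (fun _ ih x => x ∈ C ∧ ∃ y z : ℕ → X,
      (∀ n, x = (2⁻¹ : ℝ) • (y n + z n)) ∧
      (∀ n m, n ≠ m → δ ≤ ‖y n - y m‖) ∧
      (∀ n, ih (y n)) ∧ (∀ n, ih (z n)))
    (fun o _ ih x => ∀ γ (h : γ < o), ih γ h x)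

/-- `bushRoot C δ α x` : `x` is the root of a `δ`-`α`-bush contained in `C`. -/
def bushRoot (C : Set X) (δ : ℝ) (α : Ordinal) : X → Prop :=
  Ordinal.limitRecOn α (fun x => x ∈ C)
    (fun _ ih x => x ∈ C ∧ ∃ (n : ℕ) (y : Fin (n + 1) → X) (lam : Fin (n + 1) → ℝ),
      (∀ i, 0 < lam i ∧ lam i ≤ 1) ∧ (∑ i, lam i = 1) ∧
      x = ∑ i, lam i • y i ∧ (∀ i, δ ≤ ‖x - y i‖) ∧ ∀ i, ih (y i))
    (fun o _ ih x => ∀ γ (h : γ < o), ih γ h x)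

/-- `X` has the Slice Point of Continuity Property. -/
def SlicePCP (X : Type*) [NormedAddCommGroup X] [NormedSpace ℝ X] : Prop :=
  ∀ A : Set X, A.Nonempty → Bornology.IsBounded A → ∀ ε > (0 : ℝ),
    ∃ (f : X →L[ℝ] ℝ) (a : ℝ), ({y | a < f y} ∩ A).Nonempty ∧
      ∀ x ∈ {y | a < f y} ∩ A, ∃ V ∈ @nhds X (weakTop X) x, Metric.diam (V ∩ A) < ε

open Filter in
/-- In a bounded convex set, the midpoint of infinitely many pairs with `δ`-separated first
entries survives the weak derivation. -/
theorem weakDeriv_mem_of_sprawl {C : Set X} (hC : Convex ℝ C) (hb : Bornology.IsBounded C)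
    {δ : ℝ} {x : X} {y z : ℕ → X} (hx : x ∈ C) (hy : ∀ n, y n ∈ C) (hz : ∀ n, z n ∈ C)
    (hmid : ∀ n, x = (2⁻¹ : ℝ) • (y n + z n)) (hsep : ∀ n m, n ≠ m → δ ≤ ‖y n - y m‖) :
    x ∈ weakDeriv δ C := by
  refine ⟨hx, fun hmem => ?_⟩
  simp only [mem_iUnion] at hmem
  obtain ⟨V, hV, hdiam, hxV⟩ := hmem
  obtain ⟨U, hU, rfl⟩ := isOpen_induced_iff.1 hV
  set g : X → (X →L[ℝ] ℝ) → ℝ := fun x f => f x with hg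
  have hlim : ∃ a, Tendsto (fun n => g (y n)) (hyperfilter ℕ) (𝓝 a) := by
    have h : ∀ f : X →L[ℝ] ℝ, ∃ a, Tendsto (fun n => f (y n)) (hyperfilter ℕ) (𝓝 a) := by
      intro f
      have hK : IsCompact (closure (f '' C)) := (f.lipschitz.isBounded_image hb).isCompact_closure
      obtain ⟨a, -, ha⟩ := hK.ultrafilter_le_nhds' ((hyperfilter ℕ).map fun n => f (y n))
        (Ultrafilter.mem_map.2 (Filter.univ_mem'
          fun n => subset_closure (mem_image_of_mem f (hy n))))
      exact ⟨a, ha⟩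
    choose a ha using h
    exact ⟨a, tendsto_pi_nhds.2 ha⟩
  obtain ⟨a, ha⟩ := hlim
  have hpair : ∀ᶠ p : ((X →L[ℝ] ℝ) → ℝ) × ((X →L[ℝ] ℝ) → ℝ) in 𝓝 a ×ˢ 𝓝 a,
      g x + (2⁻¹ : ℝ) • (p.1 - p.2) ∈ U ∧ g x + (2⁻¹ : ℝ) • (p.2 - p.1) ∈ U := by
    rw [← nhds_prod_eq]
    refine Filter.Eventually.and ?_ ?_ <;>
    · refine ContinuousAt.eventually_mem (by fun_prop) (hU.mem_nhds ?_)
      simpa using hxV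
  obtain ⟨n, m, hnm, h₁, h₂⟩ : ∃ n m, n ≠ m ∧
      g x + (2⁻¹ : ℝ) • (g (y n) - g (y m)) ∈ U ∧
      g x + (2⁻¹ : ℝ) • (g (y m) - g (y n)) ∈ U := by
    obtain ⟨n, hn⟩ := ((ha.prodMap ha).eventually hpair).curry.exists
    have hne : ∀ᶠ m in (hyperfilter ℕ : Filter ℕ), n ≠ m := by
      refine Filter.mem_of_superset (Set.Finite.compl_mem_hyperfilter (finite_singleton n)) ?_
      intro m hm h
      exact hm h.symm
    obtain ⟨m, hm, hnm⟩ := (hn.and hne).exists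
    exact ⟨n, m, hnm, hm⟩
  have hmix : ∀ i j, (2⁻¹ : ℝ) • y i + (2⁻¹ : ℝ) • z j ∈ C := fun i j =>
    hC (hy i) (hz j) (by norm_num) (by norm_num) (by norm_num)
  have heq : ∀ i j, (2⁻¹ : ℝ) • y i + (2⁻¹ : ℝ) • z j = x + (2⁻¹ : ℝ) • (y i - y j) := by
    intro i j
    rw [hmid j]
    module
  have hmapsto : ∀ i j, g ((2⁻¹ : ℝ) • y i + (2⁻¹ : ℝ) • z j) =
      g x + (2⁻¹ : ℝ) • (g (y i) - g (y j)) := by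
    intro i j
    ext f
    simp [heq, hg]
  have hdist := Metric.dist_le_diam_of_mem (hb.subset inter_subset_right)
    (show (2⁻¹ : ℝ) • y n + (2⁻¹ : ℝ) • z m ∈ g ⁻¹' U ∩ C from
      ⟨by rw [mem_preimage, hmapsto]; exact h₁, hmix n m⟩)
    (show (2⁻¹ : ℝ) • y m + (2⁻¹ : ℝ) • z n ∈ g ⁻¹' U ∩ C from
      ⟨by rw [mem_preimage, hmapsto]; exact h₂, hmix m n⟩)
  have hdiff : (2⁻¹ : ℝ) • y n + (2⁻¹ : ℝ) • z m - ((2⁻¹ : ℝ) • y m + (2⁻¹ : ℝ) • z n) =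
      y n - y m := by
    rw [heq, heq]
    module
  rw [dist_eq_norm, hdiff] at hdist
  exact (hsep n m hnm).not_gt (hdist.trans_lt hdiam)

theorem convDeriv_subset {C : Set X} (hC : Convex ℝ C) (hcl : IsClosed C) (ε : ℝ) :
    convDeriv ε C ⊆ C :=
  closure_minimal (convexHull_min sdiff_subset hC) hcl

theorem derivIter_zero {L : Type*} [CompleteLattice L] (d : L → L) (a : L) :
    derivIter d a 0 = a :=
  Ordinal.limitRecOn_zero ..

theorem derivIter_add_one {L : Type*} [CompleteLattice L] (d : L → L) (a : L) (α : Ordinal) :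
    derivIter d a (α + 1) = d (derivIter d a α) :=
  Ordinal.limitRecOn_add_one ..

theorem derivIter_limit {L : Type*} [CompleteLattice L] (d : L → L) (a : L) {α : Ordinal}
    (hα : Order.IsSuccLimit α) : derivIter d a α = ⨅ γ < α, derivIter d a γ :=
  Ordinal.limitRecOn_limit _ _ _ _ hα

theorem sprawlRoot_zero (C : Set X) (δ : ℝ) (x : X) : sprawlRoot C δ 0 x ↔ x ∈ C := by
  rw [sprawlRoot, Ordinal.limitRecOn_zero]

theorem sprawlRoot_add_one (C : Set X) (δ : ℝ) (α : Ordinal) (x : X) :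
    sprawlRoot C δ (α + 1) x ↔ x ∈ C ∧ ∃ y z : ℕ → X,
      (∀ n, x = (2⁻¹ : ℝ) • (y n + z n)) ∧ (∀ n m, n ≠ m → δ ≤ ‖y n - y m‖) ∧
      (∀ n, sprawlRoot C δ α (y n)) ∧ (∀ n, sprawlRoot C δ α (z n)) := by
  rw [sprawlRoot, Ordinal.limitRecOn_add_one]
  rfl

theorem sprawlRoot_limit (C : Set X) (δ : ℝ) {α : Ordinal} (hα : Order.IsSuccLimit α) (x : X) :
    sprawlRoot C δ α x ↔ ∀ γ < α, sprawlRoot C δ γ x := by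
  rw [sprawlRoot, Ordinal.limitRecOn_limit _ _ _ _ hα]
  rfl

/-- The derived sets of a closed convex set are closed convex subsets of it. -/
theorem derivIter_convDeriv_closed_convex_subset {C : Set X} (hC : Convex ℝ C)
    (hcl : IsClosed C) (ε : ℝ) (α : Ordinal) :
    IsClosed (derivIter (convDeriv ε) C α) ∧ Convex ℝ (derivIter (convDeriv ε) C α) ∧
      derivIter (convDeriv ε) C α ⊆ C := by
  induction α using Ordinal.limitRecOn with
  | zero => simpa [derivIter_zero] using ⟨hcl, hC⟩
  | add_one α ih =>
    rw [derivIter_add_one]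
    exact ⟨isClosed_closure, (convex_convexHull ℝ _).closure,
      (convDeriv_subset ih.2.1 ih.1 ε).trans ih.2.2⟩
  | limit α hα ih =>
    rw [derivIter_limit _ _ hα]
    have h0 : 0 < α := hα.bot_lt
    exact ⟨isClosed_biInter fun γ hγ => (ih γ hγ).1,
      convex_iInter₂ fun γ hγ => (ih γ hγ).2.1,
      (iInf₂_le 0 h0).trans (ih 0 h0).2.2⟩

theorem mem_derivIter_of_sprawlRoot {C : Set X} (hC : Convex ℝ C) (hcl : IsClosed C)
    (hb : Bornology.IsBounded C) {δ : ℝ} {α : Ordinal} {x : X} (hx : sprawlRoot C δ α x) :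
    x ∈ derivIter (convDeriv δ) C α := by
  induction α using Ordinal.limitRecOn generalizing x with
  | zero => rwa [derivIter_zero, ← sprawlRoot_zero C δ]
  | add_one α ih =>
    rw [derivIter_add_one]
    obtain ⟨-, y, z, hmid, hsep, hy, hz⟩ := (sprawlRoot_add_one C δ α x).1 hx
    obtain ⟨-, hconv, hsub⟩ := derivIter_convDeriv_closed_convex_subset hC hcl δ α
    have hxmem : x ∈ derivIter (convDeriv δ) C α := by
      rw [hmid 0, smul_add]
      exact hconv (ih (hy 0)) (ih (hz 0)) (by norm_num) (by norm_num) (by norm_num)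
    exact subset_closure (subset_convexHull ℝ _ (weakDeriv_mem_of_sprawl hconv (hb.subset hsub)
      hxmem (fun n => ih (hy n)) (fun n => ih (hz n)) hmid hsep))
  | limit α hα ih =>
    rw [derivIter_limit _ _ hα]
    exact mem_iInter₂.2 fun γ hγ => ih γ hγ ((sprawlRoot_limit C δ hα x).1 hx γ hγ)

/-- If `B_X` contains a `δ`-`α`-sprawling tree, then its root belongs to
`γ_δ^α(B_X)`; in particular `γ_δ^α(B_X) ≠ ∅`, i.e. `C(X, δ) > α` and `C(X) > α`. -/
theorem statement6 {X : Type*} [NormedAddCommGroup X] [NormedSpace ℝ X] [CompleteSpace X]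
    (δ : ℝ) (hδ : 0 < δ) (α : Ordinal) (hα : α < (Cardinal.aleph 1).ord)
    (x : X) (hx : sprawlRoot (Metric.closedBall (0 : X) 1) δ α x) :
    x ∈ derivIter (convDeriv δ) (Metric.closedBall (0 : X) 1) α ∧
      (derivIter (convDeriv δ) (Metric.closedBall (0 : X) 1) α).Nonempty := by
  have h := mem_derivIter_of_sprawlRoot (convex_closedBall (0 : X) 1) isClosed_closedBall
    isBounded_closedBall hx
  exact ⟨h, x, h⟩
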